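/- Let 𝒯=(V,ℰ) be a leafless, locally finite rooted directed tree and let S_{λ,2} be the Dirichlet shift on ℓ²(V) with parameter q = 2. Then S_{λ,2} has the wandering subspace property: for every closed subspace M of ℓ²(V) invariant under S_{λ,2}, M equals the closed linear span of {S_{λ,2}^k f : k ∈ ℕ, f ∈ M ⊖ S_{λ,2}M}, where M ⊖ S_{λ,2}M denotes the orthogonal complement of S_{λ,2}M inside M. -/

import Mathlib

open scoped ENNReal InnerProductSpace
open ContinuousLinearMap

noncomputable section

/-- A (countably infinite) rooted directed tree. -/
structure DirTree (V : Type) where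
  edge : V → V → Prop
  not_self : ∀ v, ¬ edge v v
  no_circuit : ∀ v, ¬ Relation.TransGen edge v v
  connected : ∀ u v : V, Relation.ReflTransGen (fun a b => edge a b ∨ edge b a) u v
  uniq_parent : ∀ {u w v : V}, edge u v → edge w v → u = w
  root : V
  root_no_parent : ∀ u, ¬ edge u root
  root_uniq : ∀ v, (∀ u, ¬ edge u v) → v = root

namespace DirTree

variable {V : Type} (T : DirTree V)

/-- The set of children of a vertex. -/
def chi (v : V) : Set V := {u | T.edge v u}

/-- Leafless: every vertex has a child. -/
def Leafless : Prop := ∀ v : V, ∃ u, T.edge v u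

/-- Locally finite: every vertex has finitely many children. -/
def LocFin : Prop := ∀ v : V, (T.chi v).Finite

/-- The finset of children of a vertex (locally finite case). -/
def chiFin (hT : T.LocFin) (v : V) : Finset V := (hT v).toFinset

/-- Iterated child sets `Chi^⟨n⟩(W)`. -/
def chiIter (T : DirTree V) : ℕ → Set V → Set V
  | 0, W => W
  | n + 1, W => {u | ∃ v ∈ chiIter T n W, T.edge v u}

/-- The depth of a vertex: the unique `n` with `v ∈ Chi^⟨n⟩(root)`. -/
def depth (v : V) : ℕ := sInf {n | v ∈ T.chiIter n {T.root}}

/-- The parent map (junk value at the root). -/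
def par (v : V) : V :=
  letI := Classical.propDecidable (∃ u, T.edge u v)
  if h : ∃ u, T.edge u v then h.choose else v

end DirTree

/-- `ℓ²(V)`. -/
abbrev l2 (V : Type) := lp (fun _ : V => ℂ) 2

/-- The standard orthonormal basis vector `e_v` of `ℓ²(V)`. -/
def evec {V : Type} (v : V) : l2 V :=
  letI := Classical.decEq V
  lp.single 2 v 1

/-- The Pochhammer symbol `(x)_k = x (x+1) ⋯ (x+k-1)`. -/
def poch (x : ℝ) (k : ℕ) : ℝ := ∏ i ∈ Finset.range k, (x + i)

namespace DirTree

variable {V : Type} (T : DirTree V)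

/-- The weight `λ_{u,q}` (for any child `u` of `v`). -/
def wt (hT : T.LocFin) (q : ℝ) (v : V) : ℝ :=
  Real.sqrt (((T.depth v : ℝ) + q) / ((T.depth v : ℝ) + 1)) /
    Real.sqrt ((T.chiFin hT v).card)

/-- `S` is the Dirichlet shift with parameter `q` on `ℓ²(V)`:
`S e_v = ∑_{u ∈ Chi(v)} λ_{u,q} e_u`. -/
def IsDirichletShift (hT : T.LocFin) (q : ℝ) (S : l2 V →L[ℂ] l2 V) : Prop :=
  ∀ v : V, S (evec v) = ∑ u ∈ T.chiFin hT v, ((T.wt hT q v : ℝ) : ℂ) • evec u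

end DirTree

/-- The Cauchy dual `S (S*S)⁻¹` of a left-invertible operator. -/
def cauchyDual {V : Type} (S : l2 V →L[ℂ] l2 V) : l2 V →L[ℂ] l2 V :=
  S * Ring.inverse (ContinuousLinearMap.adjoint S * S)

section TwoIsometry

variable {H : Type*} [NormedAddCommGroup H] [InnerProductSpace ℂ H]

theorem frequently_mul_le_one_of_sum_le {a : ℕ → ℝ} {C : ℝ} (ha : ∀ n, 0 ≤ a n)
    (hC : ∀ n, ∑ k ∈ Finset.range n, a k ≤ C) (N : ℕ) : ∃ n ≥ N, (n : ℝ) * a n ≤ 1 := by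
  by_contra! hcon
  have hs : Summable a := summable_of_sum_range_le ha hC
  refine Real.not_summable_one_div_natCast
    (Summable.of_norm_bounded_eventually_nat hs ?_)
  filter_upwards [Filter.eventually_ge_atTop (N + 1)] with n hn
  have hn0 : (0 : ℝ) < n := by exact_mod_cast (by omega : 0 < n)
  have := hcon n (by omega)
  rw [Real.norm_of_nonneg (by positivity), div_le_iff₀ hn0]
  linarith

/-- `S` is a 2-isometry: `S*²S² - 2S*S + I = 0`, stated through norms. -/
def IsTwoIsometry (S : H →L[ℂ] H) : Prop :=
  ∀ x, ‖S (S x)‖ ^ 2 - 2 * ‖S x‖ ^ 2 + ‖x‖ ^ 2 = 0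

namespace IsTwoIsometry

variable {S : H →L[ℂ] H}

theorem norm_pow_sq (h : IsTwoIsometry S) (n : ℕ) (x : H) :
    ‖(S ^ n) x‖ ^ 2 = ‖x‖ ^ 2 + n * (‖S x‖ ^ 2 - ‖x‖ ^ 2) := by
  induction n generalizing x with
  | zero => simp
  | succ n ih =>
    have h1 : (S ^ (n + 1)) x = (S ^ n) (S x) := by rw [pow_succ]; rfl
    rw [h1, ih]
    push_cast
    linear_combination (n : ℝ) * h x

theorem norm_sq_le (h : IsTwoIsometry S) (x : H) : ‖x‖ ^ 2 ≤ ‖S x‖ ^ 2 := by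
  by_contra! hlt
  obtain ⟨n, hn⟩ := exists_nat_gt (‖x‖ ^ 2 / (‖x‖ ^ 2 - ‖S x‖ ^ 2))
  rw [div_lt_iff₀ (by linarith)] at hn
  have := h.norm_pow_sq n x
  nlinarith [sq_nonneg ‖(S ^ n) x‖]

theorem norm_le (h : IsTwoIsometry S) (x : H) : ‖x‖ ≤ ‖S x‖ :=
  le_of_sq_le_sq (h.norm_sq_le x) (norm_nonneg _)

theorem isClosed_map [CompleteSpace H] (h : IsTwoIsometry S) {M : Submodule ℂ H}
    (hM : IsClosed (M : Set H)) : IsClosed (M.map (S : H →ₗ[ℂ] H) : Set H) := by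
  have hanti : AntilipschitzWith 1 S :=
    S.antilipschitz_of_bound fun x => by simpa using h.norm_le x
  have := (hanti.isClosedEmbedding S.uniformContinuous).isClosedMap _ hM
  simpa using this

theorem exists_sub_orthogonal_range [CompleteSpace H] (h : IsTwoIsometry S)
    {M : Submodule ℂ H} (hM : IsClosed (M : Set H)) (x : H) :
    ∃ y ∈ M, ∀ g ∈ M, inner ℂ (x - S y) (S g) = 0 := by
  let K := M.map (S : H →ₗ[ℂ] H)
  have : CompleteSpace K := (h.isClosed_map hM).completeSpace_coe
  obtain ⟨p, hp, z, hz, rfl⟩ := K.exists_add_mem_mem_orthogonal x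
  obtain ⟨y, hy, rfl⟩ := hp
  refine ⟨y, hy, fun g hg => ?_⟩
  have := (K.mem_orthogonal' z).1 hz (S g) ⟨g, hg, rfl⟩
  simpa using this

/-- In a closed invariant subspace of a 2-isometry, a vector orthogonal to the wandering
subspace generated part has, for arbitrarily large `n`, its squared norm realised by pairing
with an element of the range of `S ^ n` of controlled size. -/
theorem exists_pow_inner_eq [CompleteSpace H] (h : IsTwoIsometry S)
    {M : Submodule ℂ H} (hM : IsClosed (M : Set H)) (hMi : ∀ f ∈ M, S f ∈ M) {x : H}
    (hx : x ∈ M)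
    (horth : ∀ (k : ℕ), ∀ f ∈ M, (∀ g ∈ M, inner ℂ f (S g) = 0) → inner ℂ ((S ^ k) f) x = 0)
    (N : ℕ) :
    ∃ n ≥ N, ∃ y, inner ℂ ((S ^ n) y) x = inner ℂ x x ∧ ‖(S ^ n) y‖ ^ 2 ≤ ‖x‖ ^ 2 + 1 := by
  choose L hLM hL using h.exists_sub_orthogonal_range hM
  have hmem : ∀ k, L^[k] x ∈ M
    | 0 => hx
    | k + 1 => by rw [Function.iterate_succ_apply']; exact hLM _
  have hpyth : ∀ k, ‖S (L^[k + 1] x)‖ ^ 2 ≤ ‖L^[k] x‖ ^ 2 := fun k => by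
    rw [Function.iterate_succ_apply']
    set y := L^[k] x
    have h1 := norm_add_sq_eq_norm_sq_add_norm_sq_of_inner_eq_zero (𝕜 := ℂ) _ _
      (hL y (L y) (hLM y))
    rw [sub_add_cancel] at h1
    nlinarith [mul_self_nonneg ‖y - S (L y)‖]
  have hsum : ∀ n, ∑ k ∈ Finset.range n, (‖S (L^[k] x)‖ ^ 2 - ‖L^[k] x‖ ^ 2)
      + ‖S (L^[n] x)‖ ^ 2 ≤ ‖S x‖ ^ 2 := fun n => by
    induction n with
    | zero => simp
    | succ n ih =>
      rw [Finset.sum_range_succ]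
      linarith [hpyth n]
  have hLn : ∀ n, ‖L^[n] x‖ ^ 2 ≤ ‖x‖ ^ 2 := fun n => by
    induction n with
    | zero => simp
    | succ n ih => linarith [hpyth n, h.norm_sq_le (L^[n + 1] x)]
  have hinner : ∀ n, inner ℂ ((S ^ n) (L^[n] x)) x = inner ℂ x x := fun n => by
    induction n with
    | zero => simp
    | succ n ih =>
      have hw := horth n (L^[n] x - S (L (L^[n] x)))
        (M.sub_mem (hmem n) (hMi _ (hLM _))) (hL _)
      rw [map_sub, inner_sub_left, sub_eq_zero, ih] at hw
      rw [hw, Function.iterate_succ_apply', pow_succ]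
      rfl
  obtain ⟨n, hn, hle⟩ := frequently_mul_le_one_of_sum_le
    (a := fun k => ‖S (L^[k] x)‖ ^ 2 - ‖L^[k] x‖ ^ 2) (C := ‖S x‖ ^ 2)
    (fun k => sub_nonneg.2 (h.norm_sq_le _))
    (fun k => by linarith [hsum k, sq_nonneg ‖S (L^[k] x)‖]) N
  refine ⟨n, hn, L^[n] x, hinner n, ?_⟩
  rw [h.norm_pow_sq]
  linarith [hLn n]

end IsTwoIsometry

end TwoIsometry

section EVec

variable {V : Type}

theorem evec_apply_self (v : V) : (evec v : V → ℂ) v = 1 := by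
  simp [evec]

theorem evec_apply_of_ne {u v : V} (h : u ≠ v) : (evec v : V → ℂ) u = 0 := by
  simp [evec, h]

theorem inner_evec_left (v : V) (f : l2 V) : ⟪evec v, f⟫_ℂ = f v := by
  classical
  rw [evec, Subsingleton.elim (Classical.decEq V) (fun a b => Classical.propDecidable (a = b)),
    lp.inner_single_left]
  simp

theorem hasSum_smul_evec (f : l2 V) : HasSum (fun v => f v • evec v) f := by
  classical
  have := lp.hasSum_single (p := 2) (by simp) f
  convert this using 2 with v
  ext u
  by_cases h : u = v
  · subst h; simp [evec]
  · simp [evec, h]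

theorem clm_eq_of_evec {A B : l2 V →L[ℂ] l2 V} (h : ∀ v, A (evec v) = B (evec v)) : A = B := by
  ext1 f
  have hA := (hasSum_smul_evec f).mapL A
  have hB := (hasSum_smul_evec f).mapL B
  simp only [map_smul, h] at hA hB
  exact hA.unique hB

end EVec

namespace DirTree

variable {V : Type} (T : DirTree V)

theorem mem_chiIter_unique {v : V} {n m : ℕ} (hn : v ∈ T.chiIter n {T.root})
    (hm : v ∈ T.chiIter m {T.root}) : n = m := by
  induction n generalizing v m with
  | zero =>
    cases m with
    | zero => rfl
    | succ m =>
      obtain rfl : v = T.root := hn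
      obtain ⟨w, -, hw⟩ := hm
      exact (T.root_no_parent w hw).elim
  | succ n ih =>
    obtain ⟨u, hu, huv⟩ := hn
    cases m with
    | zero =>
      obtain rfl : v = T.root := hm
      exact (T.root_no_parent u huv).elim
    | succ m =>
      obtain ⟨w, hw, hwv⟩ := hm
      obtain rfl := T.uniq_parent huv hwv
      rw [ih hu hw]

theorem exists_mem_chiIter (v : V) : ∃ n, v ∈ T.chiIter n {T.root} := by
  induction T.connected T.root v with
  | refl => exact ⟨0, rfl⟩
  | @tail a b _ hab ih =>
    obtain ⟨n, hn⟩ := ih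
    rcases hab with hab | hba
    · exact ⟨n + 1, a, hn, hab⟩
    · cases n with
      | zero =>
        obtain rfl : a = T.root := hn
        exact (T.root_no_parent b hba).elim
      | succ n =>
        obtain ⟨w, hw, hwa⟩ := hn
        obtain rfl := T.uniq_parent hba hwa
        exact ⟨n, hw⟩

theorem mem_chiIter_depth (v : V) : v ∈ T.chiIter (T.depth v) {T.root} :=
  Nat.sInf_mem (T.exists_mem_chiIter v)

theorem depth_of_edge {v u : V} (h : T.edge v u) : T.depth u = T.depth v + 1 :=
  T.mem_chiIter_unique (T.mem_chiIter_depth u) ⟨v, T.mem_chiIter_depth v, h⟩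

variable {T} {hT : T.LocFin}

theorem mem_chiFin {v u : V} : u ∈ T.chiFin hT v ↔ T.edge v u := by
  simp [chiFin, chi]

namespace IsDirichletShift

variable {q : ℝ} {S : l2 V →L[ℂ] l2 V}

theorem apply_evec_of_edge (hS : T.IsDirichletShift hT q S) {v u : V} (h : T.edge v u) :
    S (evec v) u = (T.wt hT q v : ℂ) := by
  rw [hS v, lp.coeFn_sum, Finset.sum_apply, Finset.sum_eq_single u]
  · rw [lp.coeFn_smul, Pi.smul_apply, evec_apply_self, smul_eq_mul, mul_one]
  · intro w _ hw
    rw [lp.coeFn_smul, Pi.smul_apply, evec_apply_of_ne hw.symm, smul_zero]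
  · exact fun hu => (hu (mem_chiFin.2 h)).elim

theorem apply_evec_of_not_edge (hS : T.IsDirichletShift hT q S) {v u : V} (h : ¬ T.edge v u) :
    S (evec v) u = 0 := by
  rw [hS v, lp.coeFn_sum, Finset.sum_apply]
  refine Finset.sum_eq_zero fun w hw => ?_
  have : u ≠ w := by rintro rfl; exact h (mem_chiFin.1 hw)
  rw [lp.coeFn_smul, Pi.smul_apply, evec_apply_of_ne this, smul_zero]

theorem inner_apply_evec (hS : T.IsDirichletShift hT q S) (v : V) (f : l2 V) :
    ⟪S (evec v), f⟫_ℂ = T.wt hT q v * ∑ u ∈ T.chiFin hT v, f u := by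
  rw [hS v, sum_inner, Finset.mul_sum]
  refine Finset.sum_congr rfl fun u _ => ?_
  rw [inner_smul_left, inner_evec_left, Complex.conj_ofReal]

theorem card_mul_wt_sq (hL : T.Leafless) (hq : 0 ≤ q) (v : V) :
    ((T.chiFin hT v).card : ℝ) * T.wt hT q v ^ 2 = (T.depth v + q) / (T.depth v + 1) := by
  obtain ⟨u, hu⟩ := hL v
  have : (0 : ℝ) < (T.chiFin hT v).card := by
    exact_mod_cast Finset.card_pos.2 ⟨u, mem_chiFin.2 hu⟩
  rw [wt, div_pow, Real.sq_sqrt (by positivity), Real.sq_sqrt this.le]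
  field_simp

theorem adjoint_apply_apply_evec (hS : T.IsDirichletShift hT q S) (hL : T.Leafless)
    (hq : 0 ≤ q) (v : V) :
    adjoint S (S (evec v)) = (((T.depth v + q) / (T.depth v + 1) : ℝ) : ℂ) • evec v := by
  ext w
  rw [← inner_evec_left, adjoint_inner_right, hS.inner_apply_evec]
  by_cases h : w = v
  · subst h
    have hsum : ∑ u ∈ T.chiFin hT w, S (evec w) u = ∑ u ∈ T.chiFin hT w, (T.wt hT q w : ℂ) :=
      Finset.sum_congr rfl fun u hu => hS.apply_evec_of_edge (mem_chiFin.1 hu)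
    rw [hsum, ← card_mul_wt_sq (hT := hT) hL hq w, lp.coeFn_smul, Pi.smul_apply, evec_apply_self,
      Finset.sum_const, nsmul_eq_mul, smul_eq_mul]
    push_cast
    ring
  · have hsum : ∑ u ∈ T.chiFin hT w, S (evec v) u = 0 :=
      Finset.sum_eq_zero fun u hu => hS.apply_evec_of_not_edge
        fun hvu => h (T.uniq_parent (mem_chiFin.1 hu) hvu)
    rw [hsum, lp.coeFn_smul, Pi.smul_apply, evec_apply_of_ne h, mul_zero, smul_zero]

theorem adjoint_sq_apply_evec (hS : T.IsDirichletShift hT q S) (hL : T.Leafless)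
    (hq : 0 ≤ q) (v : V) :
    adjoint S (adjoint S (S (S (evec v)))) =
      (((T.depth v + 1 + q) / (T.depth v + 1 + 1) * ((T.depth v + q) / (T.depth v + 1)) : ℝ) : ℂ)
        • evec v := by
  have h : adjoint S (S (S (evec v))) =
      (((T.depth v + 1 + q) / (T.depth v + 1 + 1) : ℝ) : ℂ) • S (evec v) := by
    rw [hS v, map_sum, map_sum, Finset.smul_sum]
    refine Finset.sum_congr rfl fun u hu => ?_
    rw [map_smul, map_smul, hS.adjoint_apply_apply_evec hL hq, T.depth_of_edge (mem_chiFin.1 hu),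
      smul_comm]
    push_cast
    rfl
  rw [h, map_smul, hS.adjoint_apply_apply_evec hL hq, smul_smul, ← Complex.ofReal_mul]

theorem isTwoIsometry (hS : T.IsDirichletShift hT 2 S) (hL : T.Leafless) : IsTwoIsometry S := by
  have h : adjoint S * adjoint S * S * S - (2 : ℂ) • (adjoint S * S) + 1 = 0 := by
    refine clm_eq_of_evec fun v => ?_
    have hd : (T.depth v : ℂ) + 1 ≠ 0 := Nat.cast_add_one_ne_zero _
    have hd' : (T.depth v : ℂ) + 1 + 1 ≠ 0 := by
      exact_mod_cast Nat.succ_ne_zero (T.depth v + 1)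
    change adjoint S (adjoint S (S (S (evec v)))) - (2 : ℂ) • adjoint S (S (evec v)) + evec v = 0
    rw [hS.adjoint_sq_apply_evec hL zero_le_two, hS.adjoint_apply_apply_evec hL zero_le_two,
      smul_smul, ← sub_smul]
    nth_rw 2 [← one_smul ℂ (evec v)]
    rw [← add_smul]
    convert zero_smul ℂ (evec v)
    push_cast
    field_simp
    ring
  intro x
  have hx : ⟪x, adjoint S (adjoint S (S (S x))) - (2 : ℂ) • adjoint S (S x) + x⟫_ℂ = 0 := by
    have hx0 : adjoint S (adjoint S (S (S x))) - (2 : ℂ) • adjoint S (S x) + x = 0 :=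
      DFunLike.congr_fun h x
    rw [hx0, inner_zero_right]
  rw [inner_add_right, inner_sub_right, inner_smul_right, adjoint_inner_right,
    adjoint_inner_right, adjoint_inner_right, inner_self_eq_norm_sq_to_K,
    inner_self_eq_norm_sq_to_K, inner_self_eq_norm_sq_to_K] at hx
  exact Complex.ofReal_injective (by push_cast; exact hx)

theorem pow_apply_eq_zero (hS : T.IsDirichletShift hT q S) (n : ℕ) (f : l2 V) {u : V}
    (hu : T.depth u < n) : (S ^ n) f u = 0 := by
  induction n generalizing u with
  | zero => omega
  | succ n ih =>
    have hpow : (S ^ (n + 1)) f = S ((S ^ n) f) := by rw [pow_succ']; rfl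
    rw [hpow, ← inner_evec_left]
    have hsum := ((hasSum_smul_evec ((S ^ n) f)).mapL S).mapL (innerSL ℂ (evec u))
    refine hsum.unique ?_
    convert hasSum_zero with v
    simp only [map_smul, innerSL_apply_apply, inner_evec_left]
    by_cases h : T.edge v u
    · have := T.depth_of_edge h
      rw [ih (by omega), zero_smul]
    · rw [hS.apply_evec_of_not_edge h, smul_zero]

end IsDirichletShift

end DirTree

theorem stmt_12 {V : Type} [Countable V] [Infinite V] (T : DirTree V)
    (hL : T.Leafless) (hT : T.LocFin)
    (S : l2 V →L[ℂ] l2 V) (hS : T.IsDirichletShift hT 2 S)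
    (M : Submodule ℂ (l2 V)) (hMc : IsClosed (M : Set (l2 V)))
    (hMi : ∀ f ∈ M, S f ∈ M) :
    (Submodule.span ℂ {h : l2 V | ∃ (k : ℕ) (f : l2 V), f ∈ M ∧
        (∀ g ∈ M, ⟪f, S g⟫_ℂ = 0) ∧ h = (S ^ k) f}).topologicalClosure = M := by
  have hpow : ∀ k, ∀ f ∈ M, (S ^ k) f ∈ M := fun k => by
    induction k with
    | zero => exact fun f hf => hf
    | succ k ih => exact fun f hf => by rw [pow_succ]; exact ih _ (hMi f hf)
  set W := {h : l2 V | ∃ (k : ℕ) (f : l2 V), f ∈ M ∧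
    (∀ g ∈ M, ⟪f, S g⟫_ℂ = 0) ∧ h = (S ^ k) f}
  have hNM : (Submodule.span ℂ W).topologicalClosure ≤ M := by
    refine Submodule.topologicalClosure_minimal _ (Submodule.span_le.2 ?_) hMc
    rintro _ ⟨k, f, hf, -, rfl⟩
    exact hpow k f hf
  refine le_antisymm hNM fun x hx => ?_
  have : CompleteSpace (Submodule.span ℂ W).topologicalClosure :=
    (Submodule.isClosed_topologicalClosure _).completeSpace_coe
  obtain ⟨p, hp, g, hg, rfl⟩ :=
    (Submodule.span ℂ W).topologicalClosure.exists_add_mem_mem_orthogonal x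
  have hgM : g ∈ M := (M.add_mem_iff_right (hNM hp)).1 hx
  suffices g = 0 by simpa [this] using hp
  have horth : ∀ k : ℕ, ∀ f ∈ M, (∀ g ∈ M, ⟪f, S g⟫_ℂ = 0) → ⟪(S ^ k) f, g⟫_ℂ = 0 :=
    fun k f hf hfo => (Submodule.mem_orthogonal _ _).1 hg _
      (Submodule.le_topologicalClosure _ (Submodule.subset_span ⟨k, f, hf, hfo, rfl⟩))
  by_contra hg0
  have hgpos : 0 < ‖g‖ := norm_pos_iff.2 hg0
  have hε : 0 < ‖g‖ ^ 2 / (‖g‖ + 1) := by positivity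
  obtain ⟨s, hs⟩ := ((Metric.tendsto_nhds.1 (hasSum_smul_evec g)) _ hε).exists
  obtain ⟨n, hn, y, hy, hyn⟩ := (hS.isTwoIsometry hL).exists_pow_inner_eq hMc hMi hgM horth
    (s.sup T.depth + 1)
  have hzero : ⟪(S ^ n) y, ∑ v ∈ s, g v • evec v⟫_ℂ = 0 := by
    rw [inner_sum]
    refine Finset.sum_eq_zero fun v hv => ?_
    have hv' : T.depth v < n := by
      have := Finset.le_sup (f := T.depth) hv
      omega
    rw [inner_smul_right, ← inner_conj_symm, inner_evec_left, hS.pow_apply_eq_zero n y hv']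
    simp
  have hbound : ‖g‖ ^ 2 ≤ ‖(S ^ n) y‖ * ‖g - ∑ v ∈ s, g v • evec v‖ := by
    have := norm_inner_le_norm (𝕜 := ℂ) ((S ^ n) y) (g - ∑ v ∈ s, g v • evec v)
    rw [inner_sub_right, hzero, sub_zero, hy, inner_self_eq_norm_sq_to_K] at this
    simpa using this
  have hyle : ‖(S ^ n) y‖ ≤ ‖g‖ + 1 := by
    refine le_of_sq_le_sq ?_ (by positivity)
    nlinarith
  rw [dist_comm, dist_eq_norm, lt_div_iff₀ (by positivity)] at hs
  nlinarith [norm_nonneg (g - ∑ v ∈ s, g v • evec v)]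

end
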